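/- Let $X\in[0,1]^{N\times N}$ satisfy $\|D^T X\|_0+\|XD\|_0\leq s$, and let $q\in\mathbb{R}^{N\times N}$ satisfy $\|D^{-1}(X-q)D^{-T}\|_{\max}\leq\delta/2$. If $\hat{X}$ minimizes $\|D^T Z\|_1+\|ZD\|_1$ over all $Z$ with $\|D^{-1}(Z-q)D^{-T}\|_{\max}\leq\delta/2$, then $\|D^T(\hat{X}-X)\|_1+\|(\hat{X}-X)D\|_1\leq 16\,s\,\delta$. -/

import Mathlib

open scoped BigOperators
open Finset Matrix

/-- The `N × N` finite difference matrix with `1`s on the diagonal and `-1`s on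
the subdiagonal. -/
noncomputable def Dmat (N : ℕ) : Matrix (Fin N) (Fin N) ℝ :=
  Matrix.of fun i j => if i = j then 1 else if (j : ℕ) + 1 = (i : ℕ) then -1 else 0

/-- Entrywise ℓ¹ norm of a matrix. -/
noncomputable def m1 {N : ℕ} (A : Matrix (Fin N) (Fin N) ℝ) : ℝ := ∑ i, ∑ j, |A i j|

/-- Number of nonzero entries of a matrix. -/
noncomputable def msupp {N : ℕ} (A : Matrix (Fin N) (Fin N) ℝ) : ℕ :=
  (Finset.univ.filter (fun p : Fin N × Fin N => A p.1 p.2 ≠ 0)).card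

lemma aux_sum_bound {N : ℕ} (f g : Fin N → ℝ) (c : ℝ) (hg : ∀ k, |g k| ≤ c)
    (hf : ∑ k, |f k| ≤ 2) (hc : 0 ≤ c) : |∑ k, f k * g k| ≤ 2 * c := by
  calc |∑ k, f k * g k| ≤ ∑ k, |f k * g k| := Finset.abs_sum_le_sum_abs _ _
    _ ≤ ∑ k, |f k| * c := by
        refine Finset.sum_le_sum fun k _ => ?_
        rw [abs_mul]
        exact mul_le_mul_of_nonneg_left (hg k) (abs_nonneg _)
    _ = (∑ k, |f k|) * c := by rw [Finset.sum_mul]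
    _ ≤ 2 * c := mul_le_mul_of_nonneg_right hf hc

lemma Dmat_abs_le {N : ℕ} (i j : Fin N) :
    |Dmat N i j| ≤ (if i = j then 1 else 0) + (if (j : ℕ) + 1 = (i : ℕ) then 1 else 0) := by
  simp only [Dmat, Matrix.of_apply]
  split_ifs <;> simp

lemma Dmat_row {N : ℕ} (i : Fin N) : ∑ j, |Dmat N i j| ≤ 2 := by
  refine (Finset.sum_le_sum fun j _ => Dmat_abs_le i j).trans ?_
  rw [Finset.sum_add_distrib, Finset.sum_ite_eq, Finset.sum_boole]
  have : (Finset.univ.filter fun j : Fin N => (j : ℕ) + 1 = (i : ℕ)).card ≤ 1 := by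
    refine Finset.card_le_one.2 fun a ha b hb => ?_
    simp only [Finset.mem_filter, Finset.mem_univ, true_and] at ha hb
    exact Fin.ext (by omega)
  have h2 : ((Finset.univ.filter fun j : Fin N => (j : ℕ) + 1 = (i : ℕ)).card : ℝ) ≤ 1 := by
    exact_mod_cast this
  simp only [Finset.mem_univ, if_true]
  linarith

lemma Dmat_col {N : ℕ} (j : Fin N) : ∑ i, |Dmat N i j| ≤ 2 := by
  refine (Finset.sum_le_sum fun i _ => Dmat_abs_le i j).trans ?_
  rw [Finset.sum_add_distrib, Finset.sum_ite_eq', Finset.sum_boole]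
  have : (Finset.univ.filter fun i : Fin N => (j : ℕ) + 1 = (i : ℕ)).card ≤ 1 := by
    refine Finset.card_le_one.2 fun a ha b hb => ?_
    simp only [Finset.mem_filter, Finset.mem_univ, true_and] at ha hb
    exact Fin.ext (by omega)
  have h2 : ((Finset.univ.filter fun i : Fin N => (j : ℕ) + 1 = (i : ℕ)).card : ℝ) ≤ 1 := by
    exact_mod_cast this
  simp only [Finset.mem_univ, if_true]
  linarith

lemma bound_left {N : ℕ} (A M : Matrix (Fin N) (Fin N) ℝ) (hA : ∀ i, ∑ j, |A i j| ≤ 2)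
    (c : ℝ) (hc : 0 ≤ c) (hM : ∀ i j, |M i j| ≤ c) (i j : Fin N) : |(A * M) i j| ≤ 2 * c := by
  rw [Matrix.mul_apply]
  exact aux_sum_bound (fun k => A i k) (fun k => M k j) c (fun k => hM k j) (hA i) hc

lemma bound_right {N : ℕ} (A M : Matrix (Fin N) (Fin N) ℝ) (hA : ∀ j, ∑ i, |A i j| ≤ 2)
    (c : ℝ) (hc : 0 ≤ c) (hM : ∀ i j, |M i j| ≤ c) (i j : Fin N) : |(M * A) i j| ≤ 2 * c := by
  rw [Matrix.mul_apply]
  simp only [mul_comm (M i _)]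
  exact aux_sum_bound (fun k => A k j) (fun k => M i k) c (fun k => hM i k) (hA j) hc

lemma Dmat_det (N : ℕ) : (Dmat N).det = 1 := by
  rw [Matrix.det_of_lowerTriangular]
  · simp [Dmat]
  · intro i j hij
    have h : (i : ℕ) < (j : ℕ) := hij
    have h1 : i ≠ j := fun h' => by simp [h'] at h
    have h2 : ¬ ((j : ℕ) + 1 = (i : ℕ)) := by omega
    simp [Dmat, h1, h2]

lemma m1_cone {N : ℕ} (A H : Matrix (Fin N) (Fin N) ℝ) (B : ℝ) (hH : ∀ i j, |H i j| ≤ B) :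
    m1 H ≤ m1 (A + H) - m1 A + 2 * B * msupp A := by
  have e : (2 * B * msupp A : ℝ) = ∑ i, ∑ j, if A i j ≠ 0 then 2 * B else 0 := by
    rw [← Fintype.sum_prod_type' (f := fun i j => if A i j ≠ 0 then 2 * B else 0),
      ← Finset.sum_filter, Finset.sum_const, nsmul_eq_mul, msupp, mul_comm]
  rw [e]
  unfold m1
  simp only [← Finset.sum_sub_distrib, ← Finset.sum_add_distrib]
  refine Finset.sum_le_sum fun i _ => Finset.sum_le_sum fun j _ => ?_
  rw [Matrix.add_apply]
  split_ifs with h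
  · have h1 := hH i j
    have h2 : |A i j| ≤ |A i j + H i j| + |H i j| := by
      simpa using abs_sub (A i j + H i j) (H i j)
    linarith
  · simp only [ne_eq, not_not] at h
    simp [h]

/-- the ℓ¹ bound `‖Dᵀ(X̂-X)‖₁ + ‖(X̂-X)D‖₁ ≤ 16 s δ` for the 2D
TV decoder applied to a first-order 2D Sigma Delta quantization of an image
with `‖DᵀX‖₀ + ‖XD‖₀ ≤ s`. -/
theorem sigma_delta_2d_decoder_l1_bound
    (N s : ℕ) (δ : ℝ) (hδ : 0 < δ)
    (X q : Matrix (Fin N) (Fin N) ℝ)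
    (hX : ∀ i j, X i j ∈ Set.Icc (0 : ℝ) 1)
    (hsparse : msupp ((Dmat N)ᵀ * X) + msupp (X * Dmat N) ≤ s)
    (hXfeas : ∀ i j, |((Dmat N)⁻¹ * (X - q) * ((Dmat N)⁻¹)ᵀ) i j| ≤ δ / 2)
    (Xhat : Matrix (Fin N) (Fin N) ℝ)
    (hXhatfeas : ∀ i j, |((Dmat N)⁻¹ * (Xhat - q) * ((Dmat N)⁻¹)ᵀ) i j| ≤ δ / 2)
    (hmin : ∀ Z : Matrix (Fin N) (Fin N) ℝ,
      (∀ i j, |((Dmat N)⁻¹ * (Z - q) * ((Dmat N)⁻¹)ᵀ) i j| ≤ δ / 2) →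
      m1 ((Dmat N)ᵀ * Xhat) + m1 (Xhat * Dmat N) ≤
        m1 ((Dmat N)ᵀ * Z) + m1 (Z * Dmat N)) :
    m1 ((Dmat N)ᵀ * (Xhat - X)) + m1 ((Xhat - X) * Dmat N) ≤ 16 * s * δ := by
  have hu : IsUnit (Dmat N).det := by rw [Dmat_det]; exact isUnit_one
  have hut : IsUnit ((Dmat N)ᵀ).det := by rw [Matrix.det_transpose]; exact hu
  obtain ⟨E, hE⟩ : ∃ E, E = (Dmat N)⁻¹ * (Xhat - X) * ((Dmat N)⁻¹)ᵀ := ⟨_, rfl⟩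
  have hEb : ∀ i j, |E i j| ≤ δ := by
    intro i j
    have : E = (Dmat N)⁻¹ * (Xhat - q) * ((Dmat N)⁻¹)ᵀ - (Dmat N)⁻¹ * (X - q) * ((Dmat N)⁻¹)ᵀ := by
      rw [hE, ← Matrix.sub_mul, ← Matrix.mul_sub, sub_sub_sub_cancel_right]
    rw [this, Matrix.sub_apply]
    refine (abs_sub _ _).trans ?_
    linarith [hXfeas i j, hXhatfeas i j]
  have hH : Xhat - X = Dmat N * E * (Dmat N)ᵀ := by
    rw [hE, Matrix.transpose_nonsing_inv, ← Matrix.mul_assoc,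
      Matrix.mul_nonsing_inv_cancel_left _ _ hu, Matrix.nonsing_inv_mul_cancel_right _ _ hut]
  have hHb : ∀ i j, |(Xhat - X) i j| ≤ 2 * (2 * δ) := by
    rw [hH]
    exact bound_right _ _ (fun j => Dmat_row j) _ (by positivity)
      (bound_left _ _ Dmat_row _ hδ.le hEb)
  have h1 := m1_cone ((Dmat N)ᵀ * X) ((Dmat N)ᵀ * (Xhat - X)) _
    (bound_left _ _ (fun j => Dmat_col j) _ (by positivity) hHb)
  have h2 := m1_cone (X * Dmat N) ((Xhat - X) * Dmat N) _
    (bound_right _ _ Dmat_col _ (by positivity) hHb)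
  rw [← Matrix.mul_add, add_sub_cancel] at h1
  rw [← Matrix.add_mul, add_sub_cancel] at h2
  have h3 := hmin X hXfeas
  have h4 : ((msupp ((Dmat N)ᵀ * X) : ℝ) + msupp (X * Dmat N)) ≤ s := by exact_mod_cast hsparse
  have h5 := mul_le_mul_of_nonneg_left h4 hδ.le
  linarith
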